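/- Let 0 < α ≤ 1 and let h : (0,∞) → ℝ. Then h = f^α for some complete Bernstein function f if and only if h is a complete Bernstein function and the function p ↦ p^{1−α} h(p) is a complete Bernstein function. That is, 𝔉^α = {g ∈ 𝔉 : p^{1−α} g(p) ∈ 𝔉}. -/

import Mathlib

open MeasureTheory Set Filter

/-- A Bernstein function: nonnegative, continuous on `[0,∞)`, smooth on `(0,∞)`,
with `(-1)^{n-1} f⁽ⁿ⁾(x) ≥ 0` for all `x > 0` and all integers `n ≥ 1`. -/
def IsBernstein (f : ℝ → ℝ) : Prop :=
  (∀ x : ℝ, 0 ≤ x → 0 ≤ f x) ∧ ContinuousOn f (Set.Ici 0) ∧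
  ContDiffOn ℝ (⊤ : ℕ∞) f (Set.Ioi 0) ∧
  ∀ n : ℕ, 1 ≤ n → ∀ x : ℝ, 0 < x →
    0 ≤ (-1 : ℝ) ^ (n - 1) * iteratedDerivWithin n f (Set.Ioi 0) x

/-- A complete Bernstein function: `f(x) = x² ∫₀^∞ e^{-xt} g(t) dt` for some Bernstein
function `g`. -/
def IsCBF (f : ℝ → ℝ) : Prop :=
  ∃ g : ℝ → ℝ, IsBernstein g ∧
    ∀ x : ℝ, 0 < x → f x = x ^ 2 * ∫ t in Set.Ioi (0 : ℝ), Real.exp (-x * t) * g t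

open Topology ProbabilityTheory
open scoped ContDiff unitInterval NNReal

/-- The extremal complete Bernstein functions `x ↦ x / ((1 - u) x + u)`, for `u ∈ [0, 1]`,
normalised to equal `1` at `x = 1`. -/
noncomputable def cbfKernel (x : ℝ) (u : I) : ℝ := x / ((1 - u) * x + u)

/-- Functions on `(0,∞)` that are mixtures of the kernels `cbfKernel · u`. -/
def IsCBFMixture (f : ℝ → ℝ) : Prop :=
  ∃ ν : Measure I, IsFiniteMeasure ν ∧ ∀ x : ℝ, 0 < x → f x = ∫ u, cbfKernel x u ∂ν

lemma cbfKernel_denom_pos {x : ℝ} (hx : 0 < x) (u : I) : 0 < (1 - (u : ℝ)) * x + u := by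
  have h0 := u.2.1
  have h1 := u.2.2
  rcases h0.eq_or_lt with h | h
  · rw [← h]; simpa using hx
  · have : 0 ≤ (1 - (u : ℝ)) * x := mul_nonneg (by linarith) hx.le
    linarith

lemma continuous_cbfKernel {x : ℝ} (hx : 0 < x) : Continuous (cbfKernel x) := by
  unfold cbfKernel
  exact continuous_const.div (by fun_prop) fun u => (cbfKernel_denom_pos hx u).ne'

lemma integrable_cbfKernel {x : ℝ} (hx : 0 < x) (ν : Measure I) [IsFiniteMeasure ν] :
    Integrable (cbfKernel x) ν :=
  (continuous_cbfKernel hx).integrable_of_hasCompactSupport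
    (HasCompactSupport.of_compactSpace _)

lemma cbfKernel_one (u : I) : cbfKernel 1 u = 1 := by simp [cbfKernel]

namespace IsCBFMixture

lemma kernel (u : I) : IsCBFMixture (fun x => cbfKernel x u) :=
  ⟨Measure.dirac u, inferInstance, fun x _ => by simp⟩

lemma zero : IsCBFMixture (fun _ => 0) :=
  ⟨0, inferInstance, fun x _ => by simp⟩

lemma congr {f g : ℝ → ℝ} (hf : IsCBFMixture f) (h : ∀ x, 0 < x → g x = f x) :
    IsCBFMixture g := by
  obtain ⟨ν, hν, hf⟩ := hf
  exact ⟨ν, hν, fun x hx => (h x hx).trans (hf x hx)⟩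

lemma add {f g : ℝ → ℝ} (hf : IsCBFMixture f) (hg : IsCBFMixture g) :
    IsCBFMixture (fun x => f x + g x) := by
  obtain ⟨ν, hν, hf⟩ := hf
  obtain ⟨μ, hμ, hg⟩ := hg
  refine ⟨ν + μ, inferInstance, fun x hx => ?_⟩
  rw [integral_add_measure (integrable_cbfKernel hx ν) (integrable_cbfKernel hx μ), ← hf x hx,
    ← hg x hx]

lemma const_mul {f : ℝ → ℝ} (hf : IsCBFMixture f) {c : ℝ} (hc : 0 ≤ c) :
    IsCBFMixture (fun x => c * f x) := by
  obtain ⟨ν, hν, hf⟩ := hf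
  refine ⟨c.toNNReal • ν, inferInstance, fun x hx => ?_⟩
  rw [integral_smul_nnreal_measure, ← hf x hx, NNReal.smul_def, Real.coe_toNNReal c hc, smul_eq_mul]

lemma sum {ι : Type*} (s : Finset ι) {f : ι → ℝ → ℝ} (hf : ∀ i ∈ s, IsCBFMixture (f i)) :
    IsCBFMixture (fun x => ∑ i ∈ s, f i x) := by
  classical
  induction s using Finset.induction_on with
  | empty => simpa using zero
  | insert a s ha ih =>
    simp_rw [Finset.sum_insert ha]
    exact (hf a (Finset.mem_insert_self a s)).add
      (ih fun i hi => hf i (Finset.mem_insert_of_mem hi))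

/-- A pointwise limit of mixtures is a mixture, by weak compactness of measures on `[0, 1]`. -/
lemma of_tendsto {F : ℕ → ℝ → ℝ} {f : ℝ → ℝ} (hF : ∀ n, IsCBFMixture (F n))
    (h : ∀ x, 0 < x → Tendsto (fun n => F n x) atTop (𝓝 (f x))) : IsCBFMixture f := by
  choose ν hν hF using hF
  obtain ⟨C, hC⟩ := (h 1 one_pos).bddAbove_range
  have hmass : ∀ n, (ν n).real univ ≤ C := fun n => by
    have : F n 1 ≤ C := hC ⟨n, rfl⟩
    rwa [hF n 1 one_pos, integral_congr_ae (Eventually.of_forall cbfKernel_one),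
      integral_const, smul_eq_mul, mul_one] at this
  let N : ℕ → FiniteMeasure I := fun n => ⟨ν n, hν n⟩
  have hN : ∀ n, (N n).mass ≤ C.toNNReal := fun n =>
    NNReal.le_toNNReal_of_coe_le (hmass n)
  obtain ⟨μ, -, hμ⟩ := (isCompact_setOfPred_finiteMeasure_le_of_compactSpace I
    C.toNNReal).ultrafilter_le_nhds ((Ultrafilter.of atTop).map N)
    (tendsto_principal.2 (Eventually.of_forall hN))
  refine ⟨μ, inferInstance, fun x hx => ?_⟩
  have hlim : Tendsto N (Ultrafilter.of (atTop : Filter ℕ)) (𝓝 μ) := hμ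
  rw [FiniteMeasure.tendsto_iff_forall_integral_tendsto] at hlim
  have h1 := hlim (BoundedContinuousFunction.mkOfCompact ⟨_, continuous_cbfKernel hx⟩)
  have h2 := (h x hx).mono_left (Ultrafilter.of_le (atTop : Filter ℕ))
  refine tendsto_nhds_unique h2 (h1.congr fun n => ?_)
  exact (hF n x hx).symm

end IsCBFMixture

/-- Dominated convergence for Laplace transforms preserves mixtures. -/
lemma isCBFMixture_laplace_of_tendsto {G : ℕ → ℝ → ℝ} {g : ℝ → ℝ} {C : ℝ}
    (hG : ∀ n, IsCBFMixture fun x => x ^ 2 * ∫ t in Ioi (0 : ℝ), Real.exp (-x * t) * G n t)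
    (hmeas : ∀ n, ContinuousOn (G n) (Ioi 0))
    (hbound : ∀ n, ∀ t, 0 < t → |G n t| ≤ C * (1 + t))
    (hlim : ∀ t, 0 < t → Tendsto (fun n => G n t) atTop (𝓝 (g t))) :
    IsCBFMixture fun x => x ^ 2 * ∫ t in Ioi (0 : ℝ), Real.exp (-x * t) * g t := by
  refine IsCBFMixture.of_tendsto hG fun x hx => Tendsto.const_mul _ ?_
  refine tendsto_integral_of_dominated_convergence
    (fun t => Real.exp (-x * t) * (C * (1 + t))) (fun n => ?_) ?_ (fun n => ?_) ?_
  · refine ContinuousOn.aestronglyMeasurable ?_ measurableSet_Ioi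
    exact (by fun_prop : Continuous fun t => Real.exp (-x * t)).continuousOn.mul (hmeas n)
  · have h1 := integrableOn_exp_mul_Ioi (neg_lt_zero.2 hx) 0
    have h2 : IntegrableOn (fun t : ℝ => t * Real.exp (-x * t)) (Ioi 0) := by
      have := integrableOn_rpow_mul_exp_neg_mul_rpow (p := 1) (s := 1) (b := x) (by norm_num)
        one_pos hx
      simpa using this
    refine ((h1.add h2).const_mul C).congr (Eventually.of_forall fun t => ?_)
    simp only [Pi.add_apply]
    ring
  · filter_upwards [ae_restrict_mem measurableSet_Ioi] with t ht
    rw [norm_mul, Real.norm_eq_abs, Real.norm_eq_abs, abs_of_pos (Real.exp_pos _)]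
    gcongr
    exact hbound n t ht
  · filter_upwards [ae_restrict_mem measurableSet_Ioi] with t ht
    exact (hlim t ht).const_mul _

/-- For `u ≠ 1` this is the Bernstein function whose Laplace transform is
`x ↦ cbfKernel x u / x ^ 2`; it vanishes for `u = 1`. -/
noncomputable def bernsteinKernel (t : ℝ) (u : I) : ℝ :=
  if (u : ℝ) = 0 then t else (1 - Real.exp (t * -((u : ℝ) / (1 - u)))) / u

lemma div_one_sub_nonneg (u : I) : 0 ≤ (u : ℝ) / (1 - u) :=
  div_nonneg u.2.1 (sub_nonneg.2 u.2.2)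

lemma bernsteinKernel_nonneg {t : ℝ} (ht : 0 ≤ t) (u : I) : 0 ≤ bernsteinKernel t u := by
  unfold bernsteinKernel
  split_ifs
  · exact ht
  · refine div_nonneg (sub_nonneg.2 (Real.exp_le_one_iff.2 ?_)) u.2.1
    nlinarith [mul_nonneg ht (div_one_sub_nonneg u)]

lemma bernsteinKernel_le {t : ℝ} (ht : 0 ≤ t) (u : I) : bernsteinKernel t u ≤ 1 + t := by
  unfold bernsteinKernel
  split_ifs with h
  · linarith
  · have h0 : 0 < (u : ℝ) := lt_of_le_of_ne u.2.1 (Ne.symm h)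
    have h1 := u.2.2
    rw [div_le_iff₀ h0]
    rcases h1.eq_or_lt with h1 | h1
    · rw [h1]; simp; linarith
    have e1 := Real.add_one_le_exp (t * -((u : ℝ) / (1 - u)))
    have e2 := Real.exp_pos (t * -((u : ℝ) / (1 - u)))
    have hX : (u : ℝ) / (1 - u) * (1 - u) = u := div_mul_cancel₀ _ (by linarith)
    set X := (u : ℝ) / (1 - u)
    set q := Real.exp (t * -X)
    have a1 : (1 - q) * (1 - u) ≤ t * X * (1 - u) :=
      mul_le_mul_of_nonneg_right (by linarith) (by linarith)
    have a2 : t * X * (1 - u) = t * u := by rw [mul_assoc, hX]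
    have a3 : (1 - q) * u ≤ 1 * u := mul_le_mul_of_nonneg_right (by linarith) h0.le
    nlinarith

lemma measurable_bernsteinKernel_uncurry :
    Measurable fun p : ℝ × I => bernsteinKernel p.1 p.2 := by
  unfold bernsteinKernel
  refine Measurable.ite ?_ (by fun_prop) (by fun_prop)
  exact (by fun_prop : Measurable fun p : ℝ × I => (p.2 : ℝ)) (measurableSet_singleton 0)

lemma measurable_bernsteinKernel (t : ℝ) : Measurable (bernsteinKernel t) :=
  measurable_bernsteinKernel_uncurry.comp (by fun_prop : Measurable fun u : I => (t, u))

lemma integrable_bernsteinKernel (ν : Measure I) [IsFiniteMeasure ν] {t : ℝ} (ht : 0 ≤ t) :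
    Integrable (bernsteinKernel t) ν :=
  (integrable_const (1 + t)).mono' (measurable_bernsteinKernel t).aestronglyMeasurable
    (Eventually.of_forall fun u => by
      rw [Real.norm_of_nonneg (bernsteinKernel_nonneg ht u)]
      exact bernsteinKernel_le ht u)

lemma hasDerivAt_bernsteinKernel (u : I) (t : ℝ) :
    HasDerivAt (fun t => bernsteinKernel t u)
      ((1 - (u : ℝ))⁻¹ * Real.exp (t * -((u : ℝ) / (1 - u)))) t := by
  unfold bernsteinKernel
  split_ifs with h
  · simpa [h] using hasDerivAt_id' t
  · have := ((((hasDerivAt_id t).mul_const (-((u : ℝ) / (1 - u)))).exp).const_sub 1).div_const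
      (u : ℝ)
    convert! this using 1
    simp only [id]
    field_simp

lemma inv_one_sub_mul_exp_le {ε t : ℝ} (hε : 0 < ε) (ht : ε ≤ t) (u : I) :
    (1 - (u : ℝ))⁻¹ * Real.exp (t * -((u : ℝ) / (1 - u))) ≤ 1 + ε⁻¹ := by
  have hX := div_one_sub_nonneg u
  have hW : (1 - (u : ℝ))⁻¹ ≤ 1 + (u : ℝ) / (1 - u) := by
    rcases u.2.2.eq_or_lt with h | h
    · rw [h]; simp
    · have : 0 < 1 - (u : ℝ) := sub_pos.2 h
      apply le_of_eq
      field_simp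
      ring
  set X := (u : ℝ) / (1 - u)
  have e1 : Real.exp (t * -X) ≤ Real.exp (-(ε * X)) := by
    apply Real.exp_le_exp.2
    nlinarith
  have e2 := Real.add_one_le_exp (ε * X)
  have e3 : Real.exp (-(ε * X)) * (ε * X + 1) ≤ 1 := by
    rw [Real.exp_neg, inv_mul_le_iff₀ (Real.exp_pos _)]
    linarith
  have e4 : Real.exp (-(ε * X)) ≤ 1 := Real.exp_le_one_iff.2 (by nlinarith)
  have e5 := Real.exp_pos (-(ε * X))
  calc (1 - (u : ℝ))⁻¹ * Real.exp (t * -X) ≤ (1 + X) * Real.exp (-(ε * X)) := by gcongr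
    _ = Real.exp (-(ε * X)) + Real.exp (-(ε * X)) * (ε * X) * ε⁻¹ := by field_simp
    _ ≤ 1 + 1 * ε⁻¹ := by gcongr; nlinarith
    _ = 1 + ε⁻¹ := by ring

lemma laplace_bernsteinKernel {x : ℝ} (hx : 0 < x) (u : I) :
    x ^ 2 * ∫ t in Ioi (0 : ℝ), Real.exp (-x * t) * bernsteinKernel t u =
      cbfKernel x u - indicator {1} (fun _ => x) u := by
  unfold bernsteinKernel cbfKernel
  split_ifs with h
  · have h1 : u ∉ ({1} : Set I) := by
      rintro rfl
      simp at h
    have h2 := Real.integral_rpow_mul_exp_neg_mul_Ioi (a := 2) two_pos hx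
    rw [indicator_of_notMem h1, h]
    have h3 : ∫ t in Ioi (0 : ℝ), Real.exp (-x * t) * t = (1 / x) ^ 2 := by
      have h4 : Real.Gamma 2 = 1 := Real.Gamma_two
      rw [h4, mul_one, Real.rpow_two] at h2
      rw [← h2]
      refine setIntegral_congr_fun measurableSet_Ioi fun t _ => ?_
      norm_num
      ring
    rw [h3]
    field_simp
    simp
  · by_cases h1 : u = 1
    · subst h1; simp
    · have hlt : (u : ℝ) < 1 := lt_of_le_of_ne u.2.2 fun h' => h1 (Subtype.ext h')
      have h0 : 0 < (u : ℝ) := lt_of_le_of_ne u.2.1 (Ne.symm h)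
      have hX := div_one_sub_nonneg u
      rw [indicator_of_notMem (by simpa using h1), sub_zero]
      have i1 := integrableOn_exp_mul_Ioi (neg_lt_zero.2 hx) 0
      have hneg : -(x + (u : ℝ) / (1 - u)) < 0 := by linarith
      have i2 := integrableOn_exp_mul_Ioi hneg 0
      have key : ∀ t : ℝ, Real.exp (-x * t) * ((1 - Real.exp (t * -((u : ℝ) / (1 - u)))) / u) =
          (Real.exp (-x * t) - Real.exp (-(x + (u : ℝ) / (1 - u)) * t)) * (u : ℝ)⁻¹ := fun t => by
        rw [show -(x + (u : ℝ) / (1 - u)) * t = -x * t + t * -((u : ℝ) / (1 - u)) by ring,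
          Real.exp_add]
        field_simp
      simp_rw [key]
      rw [integral_mul_const, integral_sub i1 i2, integral_exp_mul_Ioi (neg_lt_zero.2 hx),
        integral_exp_mul_Ioi hneg]
      have := cbfKernel_denom_pos hx u
      have h5 : 0 < 1 - (u : ℝ) := sub_pos.2 hlt
      have h6 : x + (u : ℝ) / (1 - u) ≠ 0 := by linarith
      have h7 : x * (1 - u) + (u : ℝ) ≠ 0 := by nlinarith
      simp only [mul_zero, Real.exp_zero]
      field_simp
      ring

lemma hasDerivAt_integral_bernsteinKernel (ν : Measure I) [IsFiniteMeasure ν] {t : ℝ}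
    (ht : 0 < t) :
    HasDerivAt (fun t => ∫ u, bernsteinKernel t u ∂ν)
      (∫ u, (1 - (u : ℝ))⁻¹ * Real.exp (t * -((u : ℝ) / (1 - u))) ∂ν) t := by
  refine (hasDerivAt_integral_of_dominated_loc_of_deriv_le
    (F' := fun t (u : I) => (1 - (u : ℝ))⁻¹ * Real.exp (t * -((u : ℝ) / (1 - u))))
    (bound := fun _ => 1 + (t / 2)⁻¹) (s := Ioi (t / 2))
    (Ioi_mem_nhds (by linarith)) (Eventually.of_forall fun s =>
      (measurable_bernsteinKernel s).aestronglyMeasurable)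
    (integrable_bernsteinKernel ν ht.le)
    (by fun_prop) ?_ (integrable_const _) ?_).2
  · refine Eventually.of_forall fun u s hs => ?_
    rw [Real.norm_of_nonneg]
    · exact inv_one_sub_mul_exp_le (by linarith) (le_of_lt hs) u
    · exact mul_nonneg (inv_nonneg.2 (sub_nonneg.2 u.2.2)) (Real.exp_pos _).le
  · exact Eventually.of_forall fun u s _ => hasDerivAt_bernsteinKernel u s

lemma exists_hasDerivAt_integral_bernsteinKernel_mgf (ν : Measure I) [IsFiniteMeasure ν] (c : ℝ) :
    ∃ μ : Measure I, (∀ t : ℝ, 0 < t → t ∈ interior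
        (integrableExpSet (fun u : I => -((u : ℝ) / (1 - u))) μ)) ∧
      ∀ t : ℝ, 0 < t → HasDerivAt (fun t => c + ∫ u, bernsteinKernel t u ∂ν)
        (mgf (fun u : I => -((u : ℝ) / (1 - u))) μ t) t := by
  have hm : Measurable fun u : I => ((1 - (u : ℝ))⁻¹).toNNReal := by fun_prop
  have hcoe : ∀ u : I, (((1 - (u : ℝ))⁻¹).toNNReal : ℝ) = (1 - (u : ℝ))⁻¹ := fun u =>
    Real.coe_toNNReal _ (inv_nonneg.2 (sub_nonneg.2 u.2.2))
  refine ⟨ν.withDensity fun u => ((1 - (u : ℝ))⁻¹).toNNReal, fun t ht => ?_, fun t ht => ?_⟩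
  · refine mem_interior_iff_mem_nhds.2 (mem_of_superset (Ioi_mem_nhds ht) fun s hs => ?_)
    change Integrable _ _
    rw [integrable_withDensity_iff_integrable_smul hm]
    refine (integrable_const (1 + s⁻¹)).mono' (by fun_prop) (Eventually.of_forall fun u => ?_)
    rw [NNReal.smul_def, hcoe, smul_eq_mul, Real.norm_of_nonneg]
    · exact inv_one_sub_mul_exp_le hs le_rfl u
    · exact mul_nonneg (inv_nonneg.2 (sub_nonneg.2 u.2.2)) (Real.exp_pos _).le
  · rw [mgf, integral_withDensity_eq_integral_smul hm]
    simp_rw [NNReal.smul_def, hcoe, smul_eq_mul]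
    exact (hasDerivAt_integral_bernsteinKernel ν ht).const_add c

lemma isBernstein_integral_bernsteinKernel (ν : Measure I) [IsFiniteMeasure ν] {c : ℝ}
    (hc : 0 ≤ c) : IsBernstein fun t => c + ∫ u, bernsteinKernel t u ∂ν := by
  obtain ⟨μ, hμ, hderiv⟩ := exists_hasDerivAt_integral_bernsteinKernel_mgf ν c
  set X : I → ℝ := fun u => -((u : ℝ) / (1 - u))
  set g : ℝ → ℝ := fun t => c + ∫ u, bernsteinKernel t u ∂ν
  have hderivWithin : ∀ t ∈ Ioi (0 : ℝ), derivWithin g (Ioi 0) t = mgf X μ t := fun t ht =>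
    (hderiv t ht).hasDerivWithinAt.derivWithin (isOpen_Ioi.uniqueDiffOn t ht)
  refine ⟨fun t ht => ?_, fun t ht => ?_, ?_, fun n hn t ht => ?_⟩
  · exact add_nonneg hc (integral_nonneg fun u => bernsteinKernel_nonneg ht u)
  · refine ContinuousWithinAt.add continuousWithinAt_const ?_
    refine continuousWithinAt_of_dominated (bound := fun _ => 1 + (t + 1))
      (Eventually.of_forall fun s => (measurable_bernsteinKernel s).aestronglyMeasurable) ?_
      (integrable_const _) (Eventually.of_forall fun u =>
        (hasDerivAt_bernsteinKernel u t).continuousAt.continuousWithinAt)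
    filter_upwards [self_mem_nhdsWithin,
      mem_nhdsWithin_of_mem_nhds (Iio_mem_nhds (lt_add_one t))] with s hs hs1
    refine Eventually.of_forall fun u => ?_
    rw [Real.norm_of_nonneg (bernsteinKernel_nonneg hs u)]
    exact (bernsteinKernel_le hs u).trans (by gcongr; exact le_of_lt hs1)
  · rw [contDiffOn_infty_iff_derivWithin isOpen_Ioi.uniqueDiffOn]
    refine ⟨fun t ht => (hderiv t ht).differentiableAt.differentiableWithinAt, ?_⟩
    refine ContDiffOn.congr ?_ hderivWithin
    exact (analyticOn_mgf.mono hμ).contDiffOn isOpen_Ioi.uniqueDiffOn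
  · obtain ⟨n, rfl⟩ := Nat.exists_eq_add_of_le' hn
    rw [iteratedDerivWithin_succ', iteratedDerivWithin_congr hderivWithin ht,
      iteratedDerivWithin_of_isOpen isOpen_Ioi ht, iteratedDeriv_mgf (hμ t ht),
      Nat.add_sub_cancel, ← integral_const_mul]
    refine integral_nonneg fun u => ?_
    change 0 ≤ (-1) ^ n * (X u ^ n * Real.exp (t * X u))
    rw [← mul_assoc, ← mul_pow]
    refine mul_nonneg (pow_nonneg ?_ n) (Real.exp_pos _).le
    simpa [X] using div_one_sub_nonneg u

lemma IsCBFMixture.isCBF {f : ℝ → ℝ} (hf : IsCBFMixture f) : IsCBF f := by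
  obtain ⟨ν, hν, hf⟩ := hf
  refine ⟨_, isBernstein_integral_bernsteinKernel ν (c := ν.real {1}) measureReal_nonneg,
    fun x hx => ?_⟩
  have i1 := integrableOn_exp_mul_Ioi (neg_lt_zero.2 hx) 0
  have i2 : IntegrableOn (fun t : ℝ => Real.exp (-x * t) * (1 + t)) (Ioi 0) := by
    have := integrableOn_rpow_mul_exp_neg_mul_rpow (p := 1) (s := 1) (b := x) (by norm_num)
      one_pos hx
    simp only [Real.rpow_one] at this
    refine (i1.add this).congr (Eventually.of_forall fun t => ?_)
    simp only [Pi.add_apply]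
    ring
  have i3 : Integrable (Function.uncurry fun (t : ℝ) (u : I) =>
      Real.exp (-x * t) * bernsteinKernel t u) ((volume.restrict (Ioi 0)).prod ν) := by
    have h := Integrable.mul_prod (μ := volume.restrict (Ioi (0 : ℝ))) (ν := ν) i2
      (integrable_const (1 : ℝ))
    refine h.mono' ?_ ?_
    · exact ((by fun_prop : Measurable fun p : ℝ × I => Real.exp (-x * p.1)).mul
        measurable_bernsteinKernel_uncurry).aestronglyMeasurable
    · have hpos : ∀ᵐ p ∂(volume.restrict (Ioi (0 : ℝ))).prod ν, 0 < p.1 :=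
        Measure.quasiMeasurePreserving_fst.ae (ae_restrict_mem measurableSet_Ioi)
      filter_upwards [hpos] with p hp
      simp only [Function.uncurry, mul_one]
      rw [Real.norm_of_nonneg (mul_nonneg (Real.exp_pos _).le (bernsteinKernel_nonneg hp.le _))]
      gcongr
      exact bernsteinKernel_le hp.le _
  have h1 : ∫ t in Ioi (0 : ℝ), Real.exp (-x * t) *
      (ν.real {1} + ∫ u, bernsteinKernel t u ∂ν) =
      ν.real {1} / x + ∫ u, (∫ t in Ioi (0 : ℝ), Real.exp (-x * t) * bernsteinKernel t u) ∂ν := by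
    rw [← integral_integral_swap i3]
    simp_rw [mul_add, integral_const_mul]
    rw [integral_add (i1.mul_const _), integral_mul_const,
      integral_exp_mul_Ioi (neg_lt_zero.2 hx)]
    · simp
      ring
    · simpa [Function.uncurry, integral_const_mul] using i3.integral_prod_left
  rw [h1, mul_add, ← integral_const_mul]
  simp_rw [laplace_bernsteinKernel hx]
  rw [integral_sub (integrable_cbfKernel hx ν)
    ((integrable_const x).indicator (measurableSet_singleton 1)),
    integral_indicator_const _ (measurableSet_singleton 1), ← hf x hx, smul_eq_mul]
  field_simp
  ring

namespace IsBernstein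

variable {g : ℝ → ℝ}

lemma contDiffAt (hg : IsBernstein g) {x : ℝ} (hx : 0 < x) : ContDiffAt ℝ (⊤ : ℕ∞) g x :=
  (hg.2.2.1 x hx).contDiffAt (Ioi_mem_nhds hx)

lemma iteratedDeriv_sign (hg : IsBernstein g) (n : ℕ) {x : ℝ} (hx : 0 < x) :
    0 ≤ (-1 : ℝ) ^ n * iteratedDeriv (n + 1) g x := by
  have := hg.2.2.2 (n + 1) (Nat.le_add_left 1 n) x hx
  rwa [iteratedDerivWithin_of_isOpen isOpen_Ioi hx] at this

lemma continuousOn_iteratedDeriv (hg : IsBernstein g) (n : ℕ) :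
    ContinuousOn (iteratedDeriv n g) (Ioi 0) :=
  (hg.2.2.1.continuousOn_iteratedDerivWithin (by exact_mod_cast le_top)
    isOpen_Ioi.uniqueDiffOn).congr fun _ hx => (iteratedDerivWithin_of_isOpen isOpen_Ioi hx).symm

lemma differentiableOn_iteratedDeriv (hg : IsBernstein g) (n : ℕ) :
    DifferentiableOn ℝ (iteratedDeriv n g) (Ioi 0) :=
  (hg.2.2.1.differentiableOn_iteratedDerivWithin (by exact_mod_cast WithTop.coe_lt_top n)
    isOpen_Ioi.uniqueDiffOn).congr fun _ hx => (iteratedDerivWithin_of_isOpen isOpen_Ioi hx).symm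

/-- The numbers `c k = (-1) ^ k * g⁽ᵏ⁺¹⁾(a) * a ^ (k + 1) / (k + 1)!`, for which the Taylor
polynomials of `g` at `a` are given by `a * (1 - q) ↦ g a - ∑ k < N, c k * q ^ (k + 1)`. -/
noncomputable def taylorCoeff (g : ℝ → ℝ) (a : ℝ) (k : ℕ) : ℝ :=
  (-1) ^ k * iteratedDeriv (k + 1) g a * a ^ (k + 1) / (k + 1).factorial

lemma taylorCoeff_nonneg (hg : IsBernstein g) {a : ℝ} (ha : 0 < a) (k : ℕ) :
    0 ≤ taylorCoeff g a k :=
  div_nonneg (mul_nonneg (hg.iteratedDeriv_sign k ha) (by positivity)) (by positivity)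

lemma intervalIntegrable_remainder (hg : IsBernstein g) (N : ℕ) {x y a : ℝ} (hy : 0 < y)
    (ha : 0 < a) : IntervalIntegrable
      (fun t => (t - x) ^ N / N.factorial * ((-1) ^ N * iteratedDeriv (N + 1) g t)) volume y a := by
  refine ContinuousOn.intervalIntegrable ?_
  refine ContinuousOn.mul (by fun_prop) (continuousOn_const.mul
    ((hg.continuousOn_iteratedDeriv _).mono fun t ht => ?_))
  exact (lt_min hy ha).trans_le ht.1

lemma taylor_remainder (hg : IsBernstein g) (N : ℕ) {q a : ℝ} (ha : 0 < a) (hq : 0 < q)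
    (hq1 : q < 1) :
    g a - ∑ k ∈ Finset.range N, taylorCoeff g a k * q ^ (k + 1) = g (a * (1 - q)) +
      ∫ t in (a * (1 - q))..a, (t - a * (1 - q)) ^ N / N.factorial *
        ((-1) ^ N * iteratedDeriv (N + 1) g t) := by
  set x := a * (1 - q) with hxdef
  have hx : 0 < x := mul_pos ha (sub_pos.2 hq1)
  have hxa : x < a := by nlinarith
  have hpos : ∀ t ∈ uIcc a x, 0 < t := fun t ht => (lt_min ha hx).trans_le ht.1
  have hD : ∀ k, ∀ t ∈ uIcc a x,
      iteratedDerivWithin k g (uIcc a x) t = iteratedDeriv k g t := fun k t ht =>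
    iteratedDerivWithin_eq_iteratedDeriv (uniqueDiffOn_uIcc hxa.ne')
      ((hg.contDiffAt (hpos t ht)).of_le (by exact_mod_cast le_top)) ht
  have h := taylor_integral_remainder (f := g) (x := x) (x₀ := a) (n := N)
    ((hg.2.2.1.mono hpos).of_le (by exact_mod_cast le_top))
  rw [taylor_within_apply, Finset.sum_range_succ', intervalIntegral.integral_symm,
    ← intervalIntegral.integral_neg] at h
  have h1 : ∫ t in x..a, -(((x - t) ^ N / N.factorial) •
      iteratedDerivWithin (N + 1) g (uIcc a x) t) =
      -∫ t in x..a, (t - x) ^ N / N.factorial * ((-1) ^ N * iteratedDeriv (N + 1) g t) := by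
    rw [← intervalIntegral.integral_neg]
    refine intervalIntegral.integral_congr fun t ht => ?_
    rw [uIcc_comm] at ht
    simp only [smul_eq_mul]
    rw [hD _ t ht, ← neg_sub t x, neg_pow (t - x)]
    ring
  have h2 : ∑ k ∈ Finset.range N, (((k + 1).factorial : ℝ)⁻¹ * (x - a) ^ (k + 1)) •
      iteratedDerivWithin (k + 1) g (uIcc a x) a =
      -∑ k ∈ Finset.range N, taylorCoeff g a k * q ^ (k + 1) := by
    rw [← Finset.sum_neg_distrib]
    refine Finset.sum_congr rfl fun k _ => ?_
    rw [hD _ a left_mem_uIcc, taylorCoeff, show x - a = -(a * q) by rw [hxdef]; ring, neg_pow,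
      mul_pow, smul_eq_mul]
    ring
  rw [h1, h2] at h
  simp only [iteratedDerivWithin_zero, Nat.factorial_zero, Nat.cast_one, inv_one, pow_zero,
    mul_one, one_smul] at h
  linarith

lemma remainder_nonneg (hg : IsBernstein g) (N : ℕ) {x a : ℝ} (hx : 0 < x) (hxa : x ≤ a) :
    0 ≤ ∫ t in x..a, (t - x) ^ N / N.factorial * ((-1) ^ N * iteratedDeriv (N + 1) g t) := by
  refine intervalIntegral.integral_nonneg hxa fun t ht => mul_nonneg ?_
    (hg.iteratedDeriv_sign N (hx.trans_le ht.1))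
  have := sub_nonneg.2 ht.1
  positivity

lemma le_taylor (hg : IsBernstein g) (N : ℕ) {q a : ℝ} (ha : 0 < a) (hq : 0 < q)
    (hq1 : q < 1) :
    g (a * (1 - q)) ≤ g a - ∑ k ∈ Finset.range N, taylorCoeff g a k * q ^ (k + 1) := by
  rw [hg.taylor_remainder N ha hq hq1, le_add_iff_nonneg_right]
  exact hg.remainder_nonneg N (mul_pos ha (sub_pos.2 hq1)) (by nlinarith)

lemma taylor_le (hg : IsBernstein g) (N : ℕ) {q a : ℝ} (ha : 0 < a) (hq : 0 ≤ q) :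
    g a - ∑ k ∈ Finset.range N, taylorCoeff g a k * q ^ (k + 1) ≤ g a :=
  sub_le_self _ (Finset.sum_nonneg fun k _ => mul_nonneg (hg.taylorCoeff_nonneg ha k)
    (by positivity))

lemma sum_taylorCoeff_le (hg : IsBernstein g) (N : ℕ) {a : ℝ} (ha : 0 < a) :
    ∑ k ∈ Finset.range N, taylorCoeff g a k ≤ g a := by
  have hc : Continuous fun q : ℝ =>
      g a - ∑ k ∈ Finset.range N, taylorCoeff g a k * q ^ (k + 1) := by fun_prop
  have h := (hc.tendsto 1).mono_left (nhdsWithin_le_nhds (s := Iio 1))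
  have := ge_of_tendsto (b := 0) h (by
    filter_upwards [self_mem_nhdsWithin,
      mem_nhdsWithin_of_mem_nhds (Ioi_mem_nhds (zero_lt_one' ℝ))] with q hq1 hq
    have hq1 : q < 1 := hq1
    exact (hg.1 _ (mul_nonneg ha.le (sub_nonneg.2 hq1.le))).trans (hg.le_taylor N ha hq hq1))
  simpa using this

lemma tendsto_taylor (hg : IsBernstein g) {q a : ℝ} (ha : 0 < a) (hq : 0 < q) (hq1 : q < 1) :
    Tendsto (fun N => g a - ∑ k ∈ Finset.range N, taylorCoeff g a k * q ^ (k + 1)) atTop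
      (𝓝 (g (a * (1 - q)))) := by
  set p := (1 + q) / 2 with hp
  have hp1 : p < 1 := by linarith
  have hqp : q < p := by linarith
  have hp0 : 0 < p := hq.trans hqp
  have hlim : Tendsto (fun N => g (a * (1 - q)) + (q / p) ^ N * g a) atTop
      (𝓝 (g (a * (1 - q)))) := by
    simpa using ((tendsto_pow_atTop_nhds_zero_of_lt_one (by positivity)
      ((div_lt_one hp0).2 hqp)).mul_const (g a)).const_add (g (a * (1 - q)))
  refine tendsto_of_tendsto_of_tendsto_of_le_of_le tendsto_const_nhds hlim
    (fun N => hg.le_taylor N ha hq hq1) fun N => ?_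
  have hR := hg.taylor_remainder N ha hp0 hp1
  have hR' := hg.taylor_le N ha hp0.le
  have hy : 0 < a * (1 - p) := mul_pos ha (sub_pos.2 hp1)
  have hx : 0 < a * (1 - q) := mul_pos ha (sub_pos.2 hq1)
  have hg0 := hg.1 _ hy.le
  have hyx : a * (1 - p) ≤ a * (1 - q) := by nlinarith
  have hxa : a * (1 - q) ≤ a := by nlinarith
  dsimp only
  rw [hg.taylor_remainder N ha hq hq1]
  gcongr
  calc
    _ ≤ ∫ t in (a * (1 - q))..a, (q / p) ^ N * ((t - a * (1 - p)) ^ N / N.factorial *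
        ((-1) ^ N * iteratedDeriv (N + 1) g t)) := by
      refine intervalIntegral.integral_mono_on hxa
        (hg.intervalIntegrable_remainder N hx ha)
        ((hg.intervalIntegrable_remainder N hx ha).const_mul _) fun t ht => ?_
      rw [← mul_assoc ((q / p) ^ N), ← mul_div_assoc, ← mul_pow]
      have h1 := sub_nonneg.2 ht.1
      gcongr
      · exact hg.iteratedDeriv_sign N (hx.trans_le ht.1)
      · rw [div_mul_eq_mul_div, le_div_iff₀ hp0]
        nlinarith [mul_nonneg (sub_nonneg.2 hqp.le) (sub_nonneg.2 ht.2)]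
    _ = (q / p) ^ N * ∫ t in (a * (1 - q))..a, (t - a * (1 - p)) ^ N / N.factorial *
        ((-1) ^ N * iteratedDeriv (N + 1) g t) := intervalIntegral.integral_const_mul _ _
    _ ≤ (q / p) ^ N * ∫ t in (a * (1 - p))..a, (t - a * (1 - p)) ^ N / N.factorial *
        ((-1) ^ N * iteratedDeriv (N + 1) g t) := by
      gcongr
      refine intervalIntegral.integral_mono_interval hyx hxa le_rfl ?_
        (hg.intervalIntegrable_remainder N hy ha)
      filter_upwards [ae_restrict_mem measurableSet_Ioc] with t ht
      have h1 := sub_nonneg.2 ht.1.le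
      exact mul_nonneg (by positivity) (hg.iteratedDeriv_sign N (hy.trans ht.1))
    _ ≤ (q / p) ^ N * g a := by
      gcongr
      linarith

lemma monotoneOn (hg : IsBernstein g) : MonotoneOn g (Ici 0) := by
  refine monotoneOn_of_deriv_nonneg (convex_Ici 0) hg.2.1 ?_ ?_
  · rw [interior_Ici]
    exact hg.2.2.1.differentiableOn (by simp)
  · rw [interior_Ici]
    intro x hx
    simpa [iteratedDeriv_one] using hg.iteratedDeriv_sign 0 hx

lemma exists_le_mul_one_add (hg : IsBernstein g) : ∃ C, ∀ t, 0 ≤ t → g t ≤ C * (1 + t) := by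
  have hanti : AntitoneOn (deriv g) (Ioi 0) := by
    rw [← iteratedDeriv_one]
    refine antitoneOn_of_deriv_nonpos (convex_Ioi 0) (hg.continuousOn_iteratedDeriv 1) ?_ ?_
    · rw [interior_Ioi]
      exact hg.differentiableOn_iteratedDeriv 1
    · rw [interior_Ioi, ← iteratedDeriv_succ]
      intro x hx
      simpa using hg.iteratedDeriv_sign 1 hx
  have h1 := hg.1 1 zero_le_one
  have h2 : 0 ≤ deriv g 1 := by simpa [iteratedDeriv_one] using hg.iteratedDeriv_sign 0 one_pos
  refine ⟨g 1 + deriv g 1, fun t ht => ?_⟩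
  rcases le_or_gt t 1 with h | h
  · have := hg.monotoneOn ht (zero_le_one' ℝ) h
    nlinarith [mul_nonneg h1 ht, mul_nonneg h2 ht]
  · obtain ⟨c, hc, hc'⟩ := exists_deriv_eq_slope g h
      (hg.2.1.mono fun s hs => zero_le_one.trans hs.1)
      ((hg.2.2.1.differentiableOn (by simp)).mono fun s hs => zero_lt_one.trans hs.1)
    have h3 := hanti (mem_Ioi.2 one_pos) (zero_lt_one.trans hc.1 : c ∈ Ioi (0 : ℝ)) hc.1.le
    rw [hc', div_le_iff₀ (sub_pos.2 h)] at h3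
    nlinarith [mul_nonneg h1 ht]

end IsBernstein

lemma isCBFMixture_id : IsCBFMixture fun x => x :=
  (IsCBFMixture.kernel 1).congr fun x _ => by simp [cbfKernel]

lemma isCBFMixture_mul_div_add {r : ℝ} (hr : 0 < r) :
    IsCBFMixture fun x => x * r / (x + r) := by
  have h : r / (1 + r) ∈ I := ⟨by positivity, (div_le_one (by positivity)).2 (by linarith)⟩
  refine ((IsCBFMixture.kernel ⟨_, h⟩).const_mul (c := r / (1 + r)) (by positivity)).congr
    fun x hx => ?_
  simp only [cbfKernel]
  have : 1 - r / (1 + r) = 1 / (1 + r) := by field_simp; ring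
  rw [this]
  field_simp

lemma isCBFMixture_laplace_exp_sum {ι : Type*} (s : Finset ι) {b r : ι → ℝ} {c : ℝ}
    (hb : ∀ i ∈ s, 0 ≤ b i) (hr : ∀ i ∈ s, 0 < r i) (hc : ∑ i ∈ s, b i ≤ c) :
    IsCBFMixture fun x => x ^ 2 * ∫ t in Ioi (0 : ℝ),
      Real.exp (-x * t) * (c - ∑ i ∈ s, b i * Real.exp (-r i * t)) := by
  refine ((isCBFMixture_id.const_mul (sub_nonneg.2 hc)).add (IsCBFMixture.sum s fun i hi =>
    (isCBFMixture_mul_div_add (hr i hi)).const_mul (hb i hi))).congr fun x hx => ?_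
  have hneg : ∀ i ∈ s, -(x + r i) < 0 := fun i hi => by linarith [hr i hi]
  have key : ∀ t : ℝ, Real.exp (-x * t) * (c - ∑ i ∈ s, b i * Real.exp (-r i * t)) =
      Real.exp (-x * t) * c - ∑ i ∈ s, b i * Real.exp (-(x + r i) * t) := fun t => by
    rw [mul_sub, Finset.mul_sum]
    congr 1
    refine Finset.sum_congr rfl fun i _ => ?_
    rw [neg_add, add_mul, Real.exp_add]
    ring
  simp_rw [key]
  have i1 := integrableOn_exp_mul_Ioi (neg_lt_zero.2 hx) 0
  rw [integral_sub (i1.mul_const c) (integrable_finsetSum _ fun i hi =>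
      (integrableOn_exp_mul_Ioi (hneg i hi) 0).const_mul _), integral_mul_const,
    integral_exp_mul_Ioi (neg_lt_zero.2 hx), integral_finsetSum _ fun i hi =>
      (integrableOn_exp_mul_Ioi (hneg i hi) 0).const_mul _, mul_sub, sub_mul, Finset.mul_sum,
    Finset.sum_mul, sub_add, ← Finset.sum_sub_distrib]
  congr 1
  · simp
    field_simp
  · refine Finset.sum_congr rfl fun i hi => ?_
    rw [integral_const_mul, integral_exp_mul_Ioi (hneg i hi)]
    have := hr i hi
    rw [mul_zero, Real.exp_zero, neg_div_neg_eq]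
    field_simp
    ring

lemma IsBernstein.isCBFMixture_laplace_comp {g : ℝ → ℝ} (hg : IsBernstein g) {a : ℝ}
    (ha : 0 < a) : IsCBFMixture fun x => x ^ 2 * ∫ t in Ioi (0 : ℝ),
      Real.exp (-x * t) * g (a * (1 - Real.exp (-(a⁻¹ * t)))) := by
  have hpow : ∀ (k : ℕ) (t : ℝ), Real.exp (-(a⁻¹ * t)) ^ (k + 1) =
      Real.exp (-((k + 1) / a) * t) := fun k t => by
    rw [← Real.exp_nat_mul]
    congr 1
    push_cast
    ring
  refine isCBFMixture_laplace_of_tendsto (C := g a) (G := fun N t =>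
    g a - ∑ k ∈ Finset.range N, taylorCoeff g a k * Real.exp (-(a⁻¹ * t)) ^ (k + 1))
    (fun N => ?_) (fun N => by fun_prop) (fun N t ht => ?_) fun t ht => ?_
  · simp_rw [hpow]
    exact isCBFMixture_laplace_exp_sum _ (fun k _ => hg.taylorCoeff_nonneg ha k)
      (fun k _ => by positivity) (hg.sum_taylorCoeff_le N ha)
  · have hq := Real.exp_pos (-(a⁻¹ * t))
    have hq1 : Real.exp (-(a⁻¹ * t)) < 1 := Real.exp_lt_one_iff.2 (neg_lt_zero.2 (by positivity))
    have h0 := (hg.1 _ (mul_nonneg ha.le (sub_nonneg.2 hq1.le))).trans (hg.le_taylor N ha hq hq1)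
    rw [abs_of_nonneg h0]
    nlinarith [hg.taylor_le N ha hq.le, mul_nonneg (hg.1 a ha.le) ht.le]
  · exact hg.tendsto_taylor ha (Real.exp_pos _)
      (Real.exp_lt_one_iff.2 (neg_lt_zero.2 (by positivity)))

lemma IsCBF.isCBFMixture {f : ℝ → ℝ} (hf : IsCBF f) : IsCBFMixture f := by
  obtain ⟨g, hg, hf⟩ := hf
  refine IsCBFMixture.congr ?_ hf
  obtain ⟨C, hC⟩ := hg.exists_le_mul_one_add
  have hpos : ∀ (n : ℕ) (t : ℝ), 0 ≤ t →
      0 ≤ ((n : ℝ) + 1) * (1 - Real.exp (-(((n : ℝ) + 1)⁻¹ * t))) := fun n t ht =>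
    mul_nonneg (by positivity) (sub_nonneg.2 (Real.exp_le_one_iff.2 (by
      rw [Left.neg_nonpos_iff]; positivity)))
  refine isCBFMixture_laplace_of_tendsto (C := C) (fun n =>
    hg.isCBFMixture_laplace_comp (a := n + 1) (by positivity)) (fun n => ?_) (fun n t ht => ?_)
    fun t ht => ?_
  · exact hg.2.1.comp (by fun_prop) fun t ht => hpos n t (le_of_lt ht)
  · rw [abs_of_nonneg (hg.1 _ (hpos n t ht.le))]
    refine (hg.monotoneOn (hpos n t ht.le) ht.le ?_).trans (hC t ht.le)
    have h := Real.add_one_le_exp (-(((n : ℝ) + 1)⁻¹ * t))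
    calc _ ≤ ((n : ℝ) + 1) * (((n : ℝ) + 1)⁻¹ * t) := by gcongr; linarith
      _ = t := by field_simp
  · refine (hg.2.1.continuousAt (Ici_mem_nhds ht)).tendsto.comp ?_
    have hd : HasDerivAt (fun s => -Real.exp (-(s * t))) t 0 := by
      convert! (((hasDerivAt_id (0 : ℝ)).mul_const t).neg.exp).neg using 1
      simp
    have h1 : Tendsto (fun n : ℕ => ((n : ℝ) + 1)⁻¹) atTop (𝓝[>] 0) :=
      tendsto_nhdsWithin_iff.2 ⟨by simpa using tendsto_one_div_add_atTop_nhds_zero_nat (𝕜 := ℝ),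
        Eventually.of_forall fun n => mem_Ioi.2 (by positivity)⟩
    refine (hd.tendsto_slope_zero_right.comp h1).congr fun n => ?_
    simp only [Function.comp_apply, zero_add, zero_mul, neg_zero, Real.exp_zero, smul_eq_mul,
      inv_inv]
    ring

/-- The kernel on the right half plane with `cbfHalfPlaneKernel x u = cbfKernel (x ^ 2) u / x`
for `x > 0`. -/
noncomputable def cbfHalfPlaneKernel (s : ℂ) (u : I) : ℂ :=
  ((1 - (u : ℝ) : ℝ) * s + (u : ℝ) / s)⁻¹

namespace cbfHalfPlaneKernel

lemma denom_re (s : ℂ) (u : I) : ((1 - (u : ℝ) : ℝ) * s + (u : ℝ) / s : ℂ).re =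
    ((1 - u) + u / Complex.normSq s) * s.re := by
  rw [Complex.add_re, Complex.re_ofReal_mul, Complex.div_re]
  simp
  ring

lemma denom_im (s : ℂ) (u : I) : ((1 - (u : ℝ) : ℝ) * s + (u : ℝ) / s : ℂ).im =
    ((1 - u) - u / Complex.normSq s) * s.im := by
  rw [Complex.add_im, Complex.im_ofReal_mul, Complex.div_im]
  simp
  ring

lemma le_denom_re {s : ℂ} {ε R : ℝ} (hε : 0 < ε) (hs : ε ≤ s.re) (hR : 1 ≤ R) (hsR : ‖s‖ ≤ R)
    (u : I) : ε / R ^ 2 ≤ ((1 - (u : ℝ) : ℝ) * s + (u : ℝ) / s : ℂ).re := by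
  have hs0 : s ≠ 0 := by rintro rfl; simp at hs; linarith
  have hn : 0 < Complex.normSq s := Complex.normSq_pos.2 hs0
  have hn' : Complex.normSq s ≤ R ^ 2 := by
    rw [Complex.normSq_eq_norm_sq]
    gcongr
  have h0 := u.2.1
  have h1 := u.2.2
  rw [denom_re, div_eq_mul_inv, mul_comm]
  have h2 : (R ^ 2)⁻¹ ≤ 1 := inv_le_one_of_one_le₀ (one_le_pow₀ hR)
  have h3 : (R ^ 2)⁻¹ ≤ (Complex.normSq s)⁻¹ := by gcongr
  have h4 : (R ^ 2)⁻¹ ≤ (1 - (u : ℝ)) + u / Complex.normSq s := by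
    rw [div_eq_mul_inv]
    nlinarith [mul_le_mul_of_nonneg_left h3 h0, mul_le_mul_of_nonneg_left h2 (sub_nonneg.2 h1)]
  exact mul_le_mul h4 hs hε.le ((by positivity : (0 : ℝ) ≤ (R ^ 2)⁻¹).trans h4)

lemma denom_re_pos {s : ℂ} (hs : 0 < s.re) (u : I) :
    0 < ((1 - (u : ℝ) : ℝ) * s + (u : ℝ) / s : ℂ).re :=
  lt_of_lt_of_le (by positivity) (le_denom_re hs le_rfl (le_max_left 1 ‖s‖) (le_max_right _ _) u)

lemma denom_ne_zero {s : ℂ} (hs : 0 < s.re) (u : I) :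
    ((1 - (u : ℝ) : ℝ) * s + (u : ℝ) / s : ℂ) ≠ 0 := fun h => by
  have := denom_re_pos hs u
  rw [h] at this
  simp at this

lemma re_pos {s : ℂ} (hs : 0 < s.re) (u : I) : 0 < (cbfHalfPlaneKernel s u).re := by
  rw [cbfHalfPlaneKernel, Complex.inv_re]
  exact div_pos (denom_re_pos hs u) (Complex.normSq_pos.2 (denom_ne_zero hs u))

lemma abs_im_mul_re_le {s : ℂ} (hs : 0 < s.re) (u : I) :
    |(cbfHalfPlaneKernel s u).im| * s.re ≤ (cbfHalfPlaneKernel s u).re * |s.im| := by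
  rw [cbfHalfPlaneKernel, Complex.inv_re, Complex.inv_im, abs_div, abs_neg,
    abs_of_nonneg (Complex.normSq_nonneg _), div_mul_eq_mul_div, div_mul_eq_mul_div, denom_im,
    denom_re, abs_mul]
  refine div_le_div_of_nonneg_right ?_ (Complex.normSq_nonneg _)
  rw [mul_assoc, mul_assoc, mul_comm s.re]
  have h0 : 0 ≤ (u : ℝ) / Complex.normSq s := div_nonneg u.2.1 (Complex.normSq_nonneg _)
  have h1 : 0 ≤ 1 - (u : ℝ) := sub_nonneg.2 u.2.2
  gcongr
  exact abs_le.2 ⟨by linarith, by linarith⟩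

lemma ofReal {x : ℝ} (hx : 0 < x) (u : I) :
    cbfHalfPlaneKernel x u = (cbfKernel (x ^ 2) u / x : ℝ) := by
  rw [cbfHalfPlaneKernel, cbfKernel, ← Complex.ofReal_mul, ← Complex.ofReal_div,
    ← Complex.ofReal_add, ← Complex.ofReal_inv]
  congr 1
  have := cbfKernel_denom_pos (pow_pos hx 2) u
  field_simp

lemma continuous {s : ℂ} (hs : 0 < s.re) : Continuous (cbfHalfPlaneKernel s) := by
  unfold cbfHalfPlaneKernel
  exact Continuous.inv₀ (by fun_prop) (denom_ne_zero hs)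

lemma hasDerivAt {s : ℂ} (hs : 0 < s.re) (u : I) :
    HasDerivAt (fun s => cbfHalfPlaneKernel s u)
      (-((1 - (u : ℝ) : ℝ) - (u : ℝ) / s ^ 2) / ((1 - (u : ℝ) : ℝ) * s + (u : ℝ) / s) ^ 2) s := by
  have hs0 : s ≠ 0 := by rintro rfl; simp at hs
  unfold cbfHalfPlaneKernel
  refine HasDerivAt.fun_inv ?_ (denom_ne_zero hs u)
  convert! ((hasDerivAt_id s).const_mul ((1 - (u : ℝ) : ℝ) : ℂ)).add
    ((hasDerivAt_inv hs0).const_mul ((u : ℝ) : ℂ)) using 1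
  ring

lemma norm_deriv_le {s : ℂ} {ε R : ℝ} (hε : 0 < ε) (hs : ε ≤ s.re) (hR : 1 ≤ R) (hsR : ‖s‖ ≤ R)
    (u : I) : ‖-(((1 - (u : ℝ) : ℝ) : ℂ) - (u : ℝ) / s ^ 2) /
      ((1 - (u : ℝ) : ℝ) * s + (u : ℝ) / s) ^ 2‖ ≤ (1 + 1 / ε ^ 2) / (ε / R ^ 2) ^ 2 := by
  have h0 := u.2.1
  have h1 := u.2.2
  have hsε : ε ≤ ‖s‖ := hs.trans ((le_abs_self _).trans (Complex.abs_re_le_norm s))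
  rw [norm_div, norm_neg, norm_pow]
  refine div_le_div₀ (by positivity) ?_ (by positivity) ?_
  · refine (norm_sub_le _ _).trans (add_le_add ?_ ?_)
    · rw [Complex.norm_real, Real.norm_of_nonneg (sub_nonneg.2 h1)]
      linarith
    · rw [norm_div, norm_pow, Complex.norm_real, Real.norm_of_nonneg h0]
      gcongr
  · gcongr
    exact (le_denom_re hε hs hR hsR u).trans
      ((le_abs_self _).trans (Complex.abs_re_le_norm _))

lemma integrable (ν : Measure I) [IsFiniteMeasure ν] {s : ℂ} (hs : 0 < s.re) :
    Integrable (cbfHalfPlaneKernel s) ν :=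
  (continuous hs).integrable_of_hasCompactSupport (HasCompactSupport.of_compactSpace _)

lemma differentiableOn_integral (ν : Measure I) [IsFiniteMeasure ν] :
    DifferentiableOn ℂ (fun s => ∫ u, cbfHalfPlaneKernel s u ∂ν) {s | 0 < s.re} := by
  intro s₀ hs₀
  have hs₀ : 0 < s₀.re := hs₀
  have hmem : ∀ s ∈ Metric.ball s₀ (s₀.re / 2), s₀.re / 2 ≤ s.re ∧ ‖s‖ ≤ 1 + ‖s₀‖ + s₀.re := by
    intro s hs
    have hs := mem_ball_iff_norm.1 hs
    have h1 := (Complex.abs_re_le_norm (s - s₀)).trans hs.le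
    rw [Complex.sub_re] at h1
    have h2 := norm_le_norm_add_norm_sub' s s₀
    exact ⟨by linarith [(abs_le.1 h1).1], by linarith⟩
  refine (hasDerivAt_integral_of_dominated_loc_of_deriv_le (𝕜 := ℂ)
    (F := cbfHalfPlaneKernel)
    (F' := fun s u => -(((1 - (u : ℝ) : ℝ) : ℂ) - (u : ℝ) / s ^ 2) /
      ((1 - (u : ℝ) : ℝ) * s + (u : ℝ) / s) ^ 2)
    (bound := fun _ => (1 + 1 / (s₀.re / 2) ^ 2) /
      (s₀.re / 2 / (1 + ‖s₀‖ + s₀.re) ^ 2) ^ 2)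
    (Metric.ball_mem_nhds s₀ (half_pos hs₀)) ?_ (integrable ν hs₀) ?_ ?_
    (integrable_const _) ?_).2.differentiableAt.differentiableWithinAt
  · filter_upwards [Metric.ball_mem_nhds s₀ (half_pos hs₀)] with s hs
    exact (integrable ν ((half_pos hs₀).trans_le (hmem s hs).1)).aestronglyMeasurable
  · exact Measurable.aestronglyMeasurable (by fun_prop)
  · exact Eventually.of_forall fun u s hs => norm_deriv_le (half_pos hs₀) (hmem s hs).1
      (by linarith [norm_nonneg s₀]) (hmem s hs).2 u
  · exact Eventually.of_forall fun u s hs =>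
      hasDerivAt ((half_pos hs₀).trans_le (hmem s hs).1) u

end cbfHalfPlaneKernel

lemma Complex.abs_arg_le_abs_arg {s w : ℂ} (hs : 0 < s.re) (hw : 0 < w.re)
    (h : |w.im| * s.re ≤ w.re * |s.im|) : |w.arg| ≤ |s.arg| := by
  have key : ∀ z : ℂ, 0 < z.re → |z.arg| < Real.pi / 2 ∧ Real.tan |z.arg| = |z.im| / z.re := by
    intro z hz
    refine ⟨Complex.abs_arg_lt_pi_div_two_iff.2 (Or.inl hz), ?_⟩
    have h1 := Complex.tan_arg z
    rcases le_or_gt 0 z.im with h | h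
    · rw [abs_of_nonneg (Complex.arg_nonneg_iff.2 h), h1, abs_of_nonneg h]
    · rw [abs_of_neg (Complex.arg_neg_iff.2 h), Real.tan_neg, h1, abs_of_neg h, neg_div]
  by_contra! hlt
  have := Real.tan_lt_tan_of_nonneg_of_lt_pi_div_two (abs_nonneg _) (key w hw).1 hlt
  rw [(key w hw).2, (key s hs).2, div_lt_div_iff₀ hs hw] at this
  linarith

namespace IsCBFMixture

lemma pos_or_eq_zero {f : ℝ → ℝ} (hf : IsCBFMixture f) :
    (∀ x, 0 < x → 0 < f x) ∨ ∀ x, 0 < x → f x = 0 := by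
  obtain ⟨ν, hν, hf⟩ := hf
  rcases eq_or_ne ν 0 with rfl | h
  · exact Or.inr fun x hx => by simp [hf x hx]
  · refine Or.inl fun x hx => ?_
    have : NeZero ν := ⟨h⟩
    rw [hf x hx]
    have hpos : ∀ u : I, 0 < cbfKernel x u := fun u => div_pos hx (cbfKernel_denom_pos hx u)
    rw [integral_pos_iff_support_of_nonneg (fun u => (hpos u).le) (integrable_cbfKernel hx ν)]
    rw [show Function.support (cbfKernel x) = univ from
      eq_univ_of_forall fun u => (hpos u).ne']
    exact Measure.measure_univ_pos.2 h

/-- A nonzero mixture `f` yields a holomorphic function on the right half plane which extends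
`x ↦ f (x ^ 2) / x` and does not increase the absolute value of the argument. -/
lemma exists_halfPlane {f : ℝ → ℝ} (hf : IsCBFMixture f) (hpos : ∀ x, 0 < x → 0 < f x) :
    ∃ G : ℂ → ℂ, DifferentiableOn ℂ G {s | 0 < s.re} ∧
      (∀ s : ℂ, 0 < s.re → 0 < (G s).re ∧ |(G s).arg| ≤ |s.arg|) ∧
      ∀ x : ℝ, 0 < x → G x = (f (x ^ 2) / x : ℝ) := by
  obtain ⟨ν, hν, hf⟩ := hf
  have hν0 : ν ≠ 0 := by
    rintro rfl
    have := hpos 1 one_pos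
    simp [hf 1 one_pos] at this
  refine ⟨_, cbfHalfPlaneKernel.differentiableOn_integral ν, fun s hs => ?_, fun x hx => ?_⟩
  · have hint := cbfHalfPlaneKernel.integrable ν hs
    have hre : (∫ u, cbfHalfPlaneKernel s u ∂ν).re = ∫ u, (cbfHalfPlaneKernel s u).re ∂ν :=
      (Complex.reCLM.integral_comp_comm hint).symm
    have him : (∫ u, cbfHalfPlaneKernel s u ∂ν).im = ∫ u, (cbfHalfPlaneKernel s u).im ∂ν :=
      (Complex.imCLM.integral_comp_comm hint).symm
    have hpos : 0 < (∫ u, cbfHalfPlaneKernel s u ∂ν).re := by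
      rw [hre, integral_pos_iff_support_of_nonneg
        (fun u => (cbfHalfPlaneKernel.re_pos hs u).le) hint.re,
        show Function.support (fun u => (cbfHalfPlaneKernel s u).re) = univ from
          eq_univ_of_forall fun u => (cbfHalfPlaneKernel.re_pos hs u).ne']
      exact Measure.measure_univ_pos.2 hν0
    refine ⟨hpos, Complex.abs_arg_le_abs_arg hs hpos ?_⟩
    rw [hre, him, ← integral_mul_const]
    calc _ ≤ (∫ u, |(cbfHalfPlaneKernel s u).im| ∂ν) * s.re := by
          gcongr
          exact abs_integral_le_integral_abs
      _ = ∫ u, |(cbfHalfPlaneKernel s u).im| * s.re ∂ν := (integral_mul_const _ _).symm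
      _ ≤ _ := integral_mono (hint.im.abs.mul_const _) (hint.re.mul_const _)
          (cbfHalfPlaneKernel.abs_im_mul_re_le hs)
  · simp_rw [cbfHalfPlaneKernel.ofReal hx]
    rw [integral_complex_ofReal, integral_div, ← hf _ (pow_pos hx 2)]

end IsCBFMixture

lemma isCBFMixture_intervalIntegral {φ : ℝ → ℝ} (hφ : Continuous φ) (hφ0 : ∀ θ, 0 ≤ φ θ)
    {u : ℝ → I} (hu : Continuous u) {b : ℝ} (hb : 0 ≤ b) :
    IsCBFMixture fun x => ∫ θ in (0 : ℝ)..b, φ θ * cbfKernel x (u θ) := by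
  have hfin : IsFiniteMeasure ((volume.restrict (Ioc 0 b)).withDensity
      fun θ => ((φ θ).toNNReal : ENNReal)) :=
    isFiniteMeasure_withDensity_ofReal
      ((hφ.integrableOn_Icc).mono_set Ioc_subset_Icc_self).hasFiniteIntegral
  refine ⟨((volume.restrict (Ioc 0 b)).withDensity fun θ => ((φ θ).toNNReal : ENNReal)).map u,
    inferInstance, fun x hx => ?_⟩
  rw [integral_map hu.aemeasurable (continuous_cbfKernel hx).aestronglyMeasurable,
    integral_withDensity_eq_integral_smul (by fun_prop)]
  refine (intervalIntegral.integral_of_le hb).trans ?_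
  refine integral_congr_ae (Eventually.of_forall fun θ => ?_)
  simp only [NNReal.smul_def, smul_eq_mul, Real.coe_toNNReal _ (hφ0 θ)]

lemma cayley_re_pos {v : ℂ} (hv : ‖v‖ < 1) : 0 < ((1 + v) / (1 - v)).re := by
  have h1 : 1 - v ≠ 0 := sub_ne_zero.2 (by rintro rfl; simp at hv)
  have h2 : ‖v‖ ^ 2 < 1 := by
    rw [sq_lt_one_iff₀ (norm_nonneg v)]
    exact hv
  rw [← Complex.normSq_eq_norm_sq, Complex.normSq_apply] at h2
  rw [Complex.div_re, ← add_div]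
  refine div_pos ?_ (Complex.normSq_pos.2 h1)
  simp
  nlinarith

lemma mul_poissonKernel_circleMap {y : ℝ} (hy : 0 < y) (θ : ℝ)
    (h : (1 + Real.cos θ) / 2 ∈ I) :
    y * poissonKernel 0 ((y - 1) / (y + 1) : ℝ) (circleMap 0 1 θ) =
      cbfKernel (y ^ 2) ⟨(1 + Real.cos θ) / 2, h⟩ := by
  have hd := cbfKernel_denom_pos (pow_pos hy 2) ⟨(1 + Real.cos θ) / 2, h⟩
  have hsq := Real.sin_sq_add_cos_sq θ
  have hn : ‖circleMap 0 1 θ - (((y - 1) / (y + 1) : ℝ) : ℂ)‖ ^ 2 =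
      4 * ((1 - (1 + Real.cos θ) / 2) * y ^ 2 + (1 + Real.cos θ) / 2) / (y + 1) ^ 2 := by
    rw [← Complex.normSq_eq_norm_sq, Complex.normSq_apply]
    have hre : (circleMap 0 1 θ).re = Real.cos θ := by simp [circleMap, Complex.exp_ofReal_mul_I_re]
    have him : (circleMap 0 1 θ).im = Real.sin θ := by simp [circleMap, Complex.exp_ofReal_mul_I_im]
    rw [Complex.sub_re, Complex.sub_im, hre, him, Complex.ofReal_re, Complex.ofReal_im, sub_zero,
      ← sq (Real.sin θ), eq_sub_of_add_eq hsq]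
    field_simp
    ring
  rw [poissonKernel, sub_zero, sub_zero, hn, norm_circleMap_zero, abs_one, Complex.norm_real,
    Real.norm_eq_abs, sq_abs, cbfKernel]
  dsimp only at hd ⊢
  generalize (1 - (1 + Real.cos θ) / 2) * y ^ 2 + (1 + Real.cos θ) / 2 = d at hd ⊢
  have hd := hd.ne'
  have hy1 : y + 1 ≠ 0 := by positivity
  field_simp
  ring

/-- The Poisson representation of a function on the disc with nonnegative real part. -/
lemma isCBFMixture_of_disc {P : ℂ → ℂ} (hP : DiffContOnCl ℂ P (Metric.ball 0 1))
    (hre : ∀ z : ℂ, ‖z‖ = 1 → 0 ≤ (P z).re) :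
    IsCBFMixture fun x => √x * (P ((√x - 1) / (√x + 1) : ℝ)).re := by
  have hu : ∀ θ : ℝ, (1 + Real.cos θ) / 2 ∈ I := fun θ =>
    ⟨by linarith [Real.neg_one_le_cos θ], by linarith [Real.cos_le_one θ]⟩
  have hcont : Continuous fun θ => P (circleMap 0 1 θ) := by
    have h := hP.continuousOn
    rw [closure_ball _ one_ne_zero] at h
    exact h.comp_continuous (continuous_circleMap 0 1) fun θ => by simp
  have hφ : Continuous fun θ => (P (circleMap 0 1 θ)).re := Complex.continuous_re.comp hcont
  refine ((isCBFMixture_intervalIntegral (u := fun θ => ⟨(1 + Real.cos θ) / 2, hu θ⟩)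
    hφ (fun θ => hre _ (by simp)) (by fun_prop) Real.two_pi_pos.le).const_mul
    (c := (2 * Real.pi)⁻¹) (by positivity)).congr fun x hx => ?_
  have hy : 0 < √x := Real.sqrt_pos.2 hx
  have hw : (((√x - 1) / (√x + 1) : ℝ) : ℂ) ∈ Metric.ball (0 : ℂ) 1 := by
    rw [mem_ball_zero_iff, Complex.norm_real, Real.norm_eq_abs, abs_lt, lt_div_iff₀ (by positivity),
      div_lt_one (by positivity)]
    constructor <;> linarith
  have hk : ∀ θ, poissonKernel 0 ((√x - 1) / (√x + 1) : ℝ) (circleMap 0 1 θ) =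
      (√x)⁻¹ * cbfKernel x ⟨(1 + Real.cos θ) / 2, hu θ⟩ := fun θ => by
    have := mul_poissonKernel_circleMap hy θ (hu θ)
    rw [Real.sq_sqrt hx.le] at this
    rw [← this, inv_mul_cancel_left₀ hy.ne']
  rw [← hP.circleAverage_poissonKernel_smul hw, Real.circleAverage_def]
  simp only [Pi.smul_apply', hk]
  have hint : IntervalIntegrable (fun θ => ((√x)⁻¹ * cbfKernel x ⟨(1 + Real.cos θ) / 2, hu θ⟩) •
      P (circleMap 0 1 θ)) volume 0 (2 * Real.pi) := by
    have hk : Continuous fun θ : ℝ => cbfKernel x ⟨(1 + Real.cos θ) / 2, hu θ⟩ :=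
      (continuous_cbfKernel hx).comp (by fun_prop)
    exact ((hk.const_mul _).smul hcont).intervalIntegrable _ _
  rw [Complex.smul_re, smul_eq_mul, ← Complex.reCLM_apply,
    ← Complex.reCLM.intervalIntegral_comp_comm hint, mul_left_comm,
    ← intervalIntegral.integral_const_mul]
  congr 1
  refine intervalIntegral.integral_congr fun θ _ => ?_
  simp only [Complex.reCLM_apply, Complex.smul_re, smul_eq_mul]
  field_simp

lemma isCBFMixture_of_halfPlane {G : ℂ → ℂ} (hG : DifferentiableOn ℂ G {s | 0 < s.re})
    (hre : ∀ s : ℂ, 0 < s.re → 0 ≤ (G s).re) :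
    IsCBFMixture fun x => √x * (G √x).re := by
  have hr : ∀ n : ℕ, (n : ℝ) / (n + 1) ∈ Ico (0 : ℝ) 1 := fun n =>
    ⟨by positivity, (div_lt_one (by positivity)).2 (by linarith)⟩
  have hnorm : ∀ (n : ℕ) (z : ℂ), ‖z‖ ≤ 1 → ‖((n / (n + 1) : ℝ) : ℂ) * z‖ < 1 := fun n z hz => by
    rw [norm_mul, Complex.norm_real, Real.norm_of_nonneg (hr n).1]
    exact mul_lt_one_of_nonneg_of_lt_one_left (hr n).1 (hr n).2 hz
  refine IsCBFMixture.of_tendsto (F := fun n x => √x * (G ((1 + ((n / (n + 1) : ℝ) : ℂ) *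
    ((√x - 1) / (√x + 1) : ℝ)) / (1 - ((n / (n + 1) : ℝ) : ℂ) * ((√x - 1) / (√x + 1) : ℝ)))).re)
    (fun n => isCBFMixture_of_disc (P := fun z => G ((1 + ((n / (n + 1) : ℝ) : ℂ) * z) /
      (1 - ((n / (n + 1) : ℝ) : ℂ) * z))) ?_ fun z hz => hre _ (cayley_re_pos (hnorm n z hz.le)))
    fun x hx => ?_
  · have hU : DifferentiableOn ℂ (fun z : ℂ => G ((1 + ((n / (n + 1) : ℝ) : ℂ) * z) /
        (1 - ((n / (n + 1) : ℝ) : ℂ) * z))) {z | ‖((n / (n + 1) : ℝ) : ℂ) * z‖ < 1} := by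
      refine hG.comp ?_ fun z hz => cayley_re_pos hz
      refine DifferentiableOn.div (by fun_prop) (by fun_prop) fun z hz => sub_ne_zero.2 fun h => ?_
      have hz : ‖((n / (n + 1) : ℝ) : ℂ) * z‖ < 1 := hz
      rw [← h] at hz
      simp at hz
    exact hU.diffContOnCl_ball fun z hz => hnorm n z (by simpa using hz)
  · have hy : 0 < √x := Real.sqrt_pos.2 hx
    have hmem : {s : ℂ | 0 < s.re} ∈ 𝓝 ((√x : ℝ) : ℂ) :=
      (isOpen_lt continuous_const Complex.continuous_re).mem_nhds (by simpa using hx)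
    have hcont := (hG.differentiableAt hmem).continuousAt
    refine ((Complex.continuous_re.tendsto _).comp (hcont.tendsto.comp ?_)).const_mul _
    have h1 : Tendsto (fun n : ℕ => (n : ℝ) / (n + 1)) atTop (𝓝 1) :=
      tendsto_natCast_div_add_atTop 1
    have h2 : ContinuousAt (fun r : ℝ => (1 + (r : ℂ) * ((√x - 1) / (√x + 1) : ℝ)) /
        (1 - (r : ℂ) * ((√x - 1) / (√x + 1) : ℝ))) 1 := by
      refine ContinuousAt.div (by fun_prop) (by fun_prop) ?_
      rw [Complex.ofReal_one, one_mul, ← Complex.ofReal_one, ← Complex.ofReal_sub,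
        Complex.ofReal_ne_zero, one_sub_div (by positivity)]
      norm_num
      positivity
    have h3 : (1 + ((1 : ℝ) : ℂ) * ((√x - 1) / (√x + 1) : ℝ)) /
        (1 - ((1 : ℝ) : ℂ) * ((√x - 1) / (√x + 1) : ℝ)) = (√x : ℝ) := by
      norm_cast
      have : √x + 1 ≠ 0 := by positivity
      field_simp
      ring_nf
    exact h3 ▸ h2.tendsto.comp h1

lemma isCBF_of_eq_zero {f : ℝ → ℝ} (hf : ∀ x, 0 < x → f x = 0) : IsCBF f :=
  (IsCBFMixture.zero.congr hf).isCBF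

lemma isCBF_of_abs_arg_le {G : ℂ → ℂ} {f k : ℝ → ℝ} {a b : ℝ} (hf : ∀ x, 0 < x → 0 < f x)
    (hG : DifferentiableOn ℂ G {s | 0 < s.re}) (hre : ∀ s : ℂ, 0 < s.re → 0 < (G s).re)
    (hGf : ∀ x : ℝ, 0 < x → G x = (f (x ^ 2) / x : ℝ))
    (harg : ∀ s : ℂ, 0 < s.re → |a * s.arg + b * (G s).arg| ≤ |s.arg|)
    (hk : ∀ x, 0 < x → k x = √x ^ (1 + a - b) * f x ^ b) : IsCBF k := by
  refine ((isCBFMixture_of_halfPlane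
    (G := fun s => Complex.exp (a * Complex.log s + b * Complex.log (G s))) ?_
    fun s hs => ?_).congr fun x hx => ?_).isCBF
  · refine (((differentiableOn_id.clog fun s hs => Or.inl hs).const_mul _).add
      ((hG.clog fun s hs => Or.inl (hre s hs)).const_mul _)).cexp
  · rw [Complex.exp_re]
    have him : (a * Complex.log s + b * Complex.log (G s)).im = a * s.arg + b * (G s).arg := by
      simp [Complex.log_im]
    rw [him]
    have hs' := Complex.abs_arg_lt_pi_div_two_iff.2 (Or.inl hs)
    have := abs_le.1 ((harg s hs).trans hs'.le)
    exact mul_nonneg (Real.exp_pos _).le (Real.cos_nonneg_of_mem_Icc ⟨by linarith, this.2⟩)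
  · have hy : 0 < √x := Real.sqrt_pos.2 hx
    have hfx := hf x hx
    rw [hGf _ hy, Real.sq_sqrt hx.le, ← Complex.ofReal_log hy.le,
      ← Complex.ofReal_log (div_pos hfx hy).le, ← Complex.ofReal_mul, ← Complex.ofReal_mul,
      ← Complex.ofReal_add, Complex.exp_ofReal_re, hk x hx, Real.exp_add, mul_comm a, mul_comm b,
      ← Real.rpow_def_of_pos hy, ← Real.rpow_def_of_pos (div_pos hfx hy),
      Real.div_rpow hfx.le hy.le, Real.rpow_sub hy, Real.rpow_add hy, Real.rpow_one]
    ring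

lemma IsCBF.pos_or_eq_zero {f : ℝ → ℝ} (hf : IsCBF f) :
    (∀ x, 0 < x → 0 < f x) ∨ ∀ x, 0 < x → f x = 0 :=
  hf.isCBFMixture.pos_or_eq_zero

lemma Complex.eqOn_re_pos_of_eq_ofReal {F G : ℂ → ℂ} (hF : DifferentiableOn ℂ F {s | 0 < s.re})
    (hG : DifferentiableOn ℂ G {s | 0 < s.re}) (h : ∀ x : ℝ, 0 < x → F x = G x) :
    EqOn F G {s | 0 < s.re} := by
  have hopen : IsOpen {s : ℂ | 0 < s.re} := isOpen_lt continuous_const Complex.continuous_re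
  refine (hF.analyticOnNhd hopen).eqOn_of_preconnected_of_frequently_eq (hG.analyticOnNhd hopen)
    (convex_halfSpace_re_gt 0).isPreconnected (z₀ := ((1 : ℝ) : ℂ)) (by simp) ?_
  have ht : Tendsto (fun x : ℝ => (x : ℂ)) (𝓝[≠] 1) (𝓝[≠] ((1 : ℝ) : ℂ)) :=
    tendsto_nhdsWithin_iff.2 ⟨(Complex.continuous_ofReal.tendsto 1).mono_left nhdsWithin_le_nhds,
      eventually_nhdsWithin_of_forall fun x hx => by simpa using hx⟩
  refine ht.frequently (Eventually.frequently ?_)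
  filter_upwards [mem_nhdsWithin_of_mem_nhds (Ioi_mem_nhds (zero_lt_one' ℝ))] with x hx
  exact h x hx

lemma IsCBF.rpow {f : ℝ → ℝ} (hf : IsCBF f) {α : ℝ} (hα0 : 0 < α) (hα1 : α ≤ 1) :
    IsCBF fun p => f p ^ α := by
  rcases hf.pos_or_eq_zero with hpos | h0
  · obtain ⟨G, hG, hre, hGf⟩ := hf.isCBFMixture.exists_halfPlane hpos
    refine isCBF_of_abs_arg_le (a := α - 1) (b := α) hpos hG (fun s hs => (hre s hs).1) hGf
      (fun s hs => ?_) fun x hx => by simp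
    refine (abs_add_le _ _).trans ?_
    rw [abs_mul, abs_mul, abs_of_nonpos (sub_nonpos.2 hα1), abs_of_pos hα0]
    nlinarith [(hre s hs).2]
  · exact isCBF_of_eq_zero fun x hx => by rw [h0 x hx, Real.zero_rpow hα0.ne']

lemma IsCBF.rpow_one_sub_mul_rpow {f : ℝ → ℝ} (hf : IsCBF f) {α : ℝ} (hα0 : 0 < α)
    (hα1 : α ≤ 1) : IsCBF fun p => p ^ (1 - α) * f p ^ α := by
  rcases hf.pos_or_eq_zero with hpos | h0
  · obtain ⟨G, hG, hre, hGf⟩ := hf.isCBFMixture.exists_halfPlane hpos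
    refine isCBF_of_abs_arg_le (a := 1 - α) (b := α) hpos hG (fun s hs => (hre s hs).1) hGf
      (fun s hs => ?_) fun x hx => ?_
    · refine (abs_add_le _ _).trans ?_
      rw [abs_mul, abs_mul, abs_of_nonneg (sub_nonneg.2 hα1), abs_of_pos hα0]
      nlinarith [(hre s hs).2]
    · rw [Real.sqrt_eq_rpow, ← Real.rpow_mul hx.le]
      ring_nf
  · exact isCBF_of_eq_zero fun x hx => by rw [h0 x hx, Real.zero_rpow hα0.ne', mul_zero]

lemma IsCBF.rpow_inv {h : ℝ → ℝ} {α : ℝ} (hα0 : 0 < α) (hα1 : α ≤ 1) (hh : IsCBF h)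
    (hh' : IsCBF fun p => p ^ (1 - α) * h p) : IsCBF fun p => h p ^ α⁻¹ := by
  rcases hh.pos_or_eq_zero with hpos | h0
  · obtain ⟨G₁, hG₁, hre₁, hGf₁⟩ := hh.isCBFMixture.exists_halfPlane hpos
    obtain ⟨G₂, hG₂, hre₂, hGf₂⟩ := hh'.isCBFMixture.exists_halfPlane
      fun x hx => mul_pos (Real.rpow_pos_of_pos hx _) (hpos x hx)
    have heq : EqOn G₂ (fun s => Complex.exp ((2 - 2 * α : ℝ) * Complex.log s +
        Complex.log (G₁ s))) {s | 0 < s.re} := by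
      refine Complex.eqOn_re_pos_of_eq_ofReal hG₂ ?_ fun x hx => ?_
      · exact (((differentiableOn_id.clog fun s hs => Or.inl hs).const_mul _).add
          (hG₁.clog fun s hs => Or.inl (hre₁ s hs).1)).cexp
      · have hq : 0 < h (x ^ 2) / x := div_pos (hpos _ (pow_pos hx 2)) hx
        rw [hGf₁ x hx, hGf₂ x hx, Complex.exp_add, Complex.exp_log
          (by exact_mod_cast hq.ne'), ← Complex.ofReal_log hx.le, ← Complex.ofReal_mul,
          ← Complex.ofReal_exp, ← Complex.ofReal_mul, mul_comm _ (Real.log x),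
          ← Real.rpow_def_of_pos hx, ← Real.rpow_natCast x 2, ← Real.rpow_mul hx.le, mul_div_assoc]
        congr 4
        push_cast
        ring
    refine isCBF_of_abs_arg_le (a := α⁻¹ - 1) (b := α⁻¹) hpos hG₁ (fun s hs => (hre₁ s hs).1) hGf₁
      (fun s hs => ?_) fun x hx => by simp
    have hs' := Complex.abs_arg_lt_pi_div_two_iff.2 (Or.inl hs)
    have h1 := (hre₁ s hs).2
    have h2 := (hre₂ s hs).2
    have hne : G₂ s ≠ 0 := fun h0 => by
      have := (hre₂ s hs).1
      simp [h0] at this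
    have harg : (G₂ s).arg = (2 - 2 * α) * s.arg + (G₁ s).arg := by
      have he := heq hs
      rw [← Complex.exp_log hne, Complex.exp_eq_exp_iff_exists_int] at he
      obtain ⟨n, hn⟩ := he
      have hn := congrArg Complex.im hn
      simp only [Complex.log_im, Complex.add_im, Complex.im_ofReal_mul] at hn
      have him : ((n : ℂ) * (2 * Real.pi * Complex.I)).im = n * (2 * Real.pi) := by simp
      rw [him] at hn
      have hlt : |(n : ℝ)| < 1 := by
        have hb : |(n : ℝ) * (2 * Real.pi)| < 2 * Real.pi := by
          have h3 : (n : ℝ) * (2 * Real.pi) =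
            (G₂ s).arg + -((2 - 2 * α) * s.arg) + -(G₁ s).arg := by linarith
          rw [h3]
          have h4 := abs_add_three (G₂ s).arg (-((2 - 2 * α) * s.arg)) (-(G₁ s).arg)
          rw [abs_neg, abs_neg, abs_mul, abs_of_nonneg (by linarith : 0 ≤ 2 - 2 * α)] at h4
          nlinarith [abs_nonneg s.arg]
        rw [abs_mul, abs_of_pos Real.two_pi_pos] at hb
        nlinarith [Real.two_pi_pos]
      have hn0 : n = 0 := Int.abs_lt_one_iff.1 (by exact_mod_cast hlt)
      simpa [hn0] using hn
    rw [harg] at h2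
    rw [show (α⁻¹ - 1) * s.arg + α⁻¹ * (G₁ s).arg = ((1 - α) * s.arg + (G₁ s).arg) / α by
      field_simp, abs_div, abs_of_pos hα0, div_le_iff₀ hα0]
    obtain ⟨h1l, h1u⟩ := abs_le.1 h1
    obtain ⟨h2l, h2u⟩ := abs_le.1 h2
    rcases le_total 0 s.arg with hθ | hθ
    · rw [abs_of_nonneg hθ] at *
      exact abs_le.2 ⟨by linarith, by linarith⟩
    · rw [abs_of_nonpos hθ] at *
      exact abs_le.2 ⟨by linarith, by linarith⟩
  · exact isCBF_of_eq_zero fun x hx => by rw [h0 x hx, Real.zero_rpow (inv_ne_zero hα0.ne')]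

lemma IsCBF.nonneg {f : ℝ → ℝ} (hf : IsCBF f) {x : ℝ} (hx : 0 < x) : 0 ≤ f x := by
  rcases hf.pos_or_eq_zero with h | h
  · exact (h x hx).le
  · exact (h x hx).ge

lemma IsCBF.congr {f g : ℝ → ℝ} (hf : IsCBF f) (h : ∀ x, 0 < x → g x = f x) : IsCBF g :=
  (hf.isCBFMixture.congr h).isCBF

/-- for `0 < α ≤ 1`, `h = f^α` for some complete Bernstein function `f` if
and only if `h` is a complete Bernstein function and `p ↦ p^{1-α} h(p)` is a complete
Bernstein function; that is, `𝔉^α = {g ∈ 𝔉 : p^{1-α} g(p) ∈ 𝔉}`. -/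
theorem cbf_rpow_characterization (α : ℝ) (hα0 : 0 < α) (hα1 : α ≤ 1) (h : ℝ → ℝ) :
    (∃ f : ℝ → ℝ, IsCBF f ∧ ∀ p : ℝ, 0 < p → h p = f p ^ α) ↔
    (IsCBF h ∧ IsCBF (fun p => p ^ (1 - α) * h p)) := by
  constructor
  · rintro ⟨f, hf, hh⟩
    exact ⟨(hf.rpow hα0 hα1).congr hh, (hf.rpow_one_sub_mul_rpow hα0 hα1).congr
      fun p hp => by rw [hh p hp]⟩
  · rintro ⟨h1, h2⟩
    refine ⟨_, h1.rpow_inv hα0 hα1 h2, fun p hp => ?_⟩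
    rw [← Real.rpow_mul (h1.nonneg hp), inv_mul_cancel₀ hα0.ne', Real.rpow_one]
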